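/- Let λ be a partition and T ∈ Ω(λ). Then the family of elements of K = ℚ(q)((t)) indexed by τ ∈ APSYT(λ;T), t^{inv(τ)} · Π_{(□_1,□_2) ∈ Inv(τ)} (1 − q^{T(□_2)−T(□_1)} t^{c(□_2)−c(□_1)−1})/(1 − q^{T(□_2)−T(□_1)} t^{c(□_2)−c(□_1)+1}), is summable in the t-adic topology of K, and its sum equals (Π_{□ ∈ λ^{(rk(T))}} (1 − q^{−T(□)} t^{rk(T)−|λ|−c(□)}) / ((1−t)^{rk(T)} · [μ(T|_{λ^{(rk(T))}})]_t!)) · Π_{(□_1,□_2) ∈ I(T|_{λ^{(rk(T))}})} (1 − q^{T(□_2)−T(□_1)} t^{c(□_2)−c(□_1)})/(1 − q^{T(□_2)−T(□_1)} t^{c(□_2)−c(□_1)+1}). In particular, the sum of the series lies in the image of ℚ(q,t) in K. -/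

import Mathlib

open scoped Classical

/-- The content of a box `(i, j)` (row `i`, column `j`, both 0-indexed): `c(□) = j - i`. -/
def content (c : ℕ × ℕ) : ℤ := (c.2 : ℤ) - (c.1 : ℤ)

/-- Membership in the infinite diagram `λ^{(∞)}`: an infinite first row atop a copy of
the partition `λ` shifted down by one row. -/
def cellInf (μ : YoungDiagram) : ℕ × ℕ → Prop
  | (0, _) => True
  | (i + 1, j) => (i, j) ∈ μ

/-- Membership in the padded partition `λ^{(n)} = (n − |λ|, λ₁, …, λ_r)`. -/
def cellN (μ : YoungDiagram) (n : ℕ) : ℕ × ℕ → Prop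
  | (0, j) => j < n - μ.card
  | (i + 1, j) => (i, j) ∈ μ

/-- `n_λ := |λ| + λ₁`. -/
def nLam (μ : YoungDiagram) : ℕ := μ.card + μ.rowLen 0

/-- `T ∈ Ω(λ)`: a labelling of `λ^{(∞)}` by non-negative integers, with finitely many
nonzero values, weakly decreasing along rows and strictly decreasing down columns
(normalized to `0` off `λ^{(∞)}`). -/
def IsOmega (μ : YoungDiagram) (T : ℕ × ℕ → ℕ) : Prop :=
  (∀ c, ¬ cellInf μ c → T c = 0) ∧
  {c : ℕ × ℕ | T c ≠ 0}.Finite ∧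
  (∀ c : ℕ × ℕ, cellInf μ c → cellInf μ (c.1, c.2 + 1) → T (c.1, c.2 + 1) ≤ T c) ∧
  (∀ c : ℕ × ℕ, cellInf μ c → cellInf μ (c.1 + 1, c.2) → T (c.1 + 1, c.2) < T c)

/-- The degree `deg(T) = Σ_{□ ∈ λ^{(∞)}} T(□)`. -/
noncomputable def degOmega (T : ℕ × ℕ → ℕ) : ℕ := ∑ᶠ c, T c

/-- The rank `rk(T)`: the least `n ≥ n_λ` such that `T` vanishes on `λ^{(∞)} ∖ λ^{(n)}`. -/
noncomputable def rkOmega (μ : YoungDiagram) (T : ℕ × ℕ → ℕ) : ℕ :=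
  sInf {n | nLam μ ≤ n ∧ ∀ c, cellInf μ c → ¬ cellN μ n c → T c = 0}

/-- The order on the formal labels `j·q^b` (encoded as pairs `(j, b)`):
`j·q^m < k·q^ℓ` iff `m > ℓ`, or `m = ℓ` and `j < k`. -/
def labelLT (x y : ℕ × ℕ) : Prop := y.2 < x.2 ∨ (x.2 = y.2 ∧ x.1 < y.1)

/-- Column-standard reading order on boxes: columns left to right, each column top to
bottom. -/
def colReadLT (c c' : ℕ × ℕ) : Prop := c.2 < c'.2 ∨ (c.2 = c'.2 ∧ c.1 < c'.1)

/-- The box order `□ <_T □'`: `T □ > T □'`, or `T □ = T □'` and `□` precedes `□'` in the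
column-standard reading order. -/
def boxLT (T : ℕ × ℕ → ℕ) (c c' : ℕ × ℕ) : Prop :=
  T c' < T c ∨ (T c = T c' ∧ colReadLT c c')

/-- `τ ∈ APSYT(λ;T)`: a labelling of `λ^{(∞)}` by symbols `i·q^a` (encoded as pairs
`(i, a)`) in which every positive integer occurs exactly once, strictly increasing along
rows and columns, with only finitely many boxes carrying a positive power of `q`, and
whose `q`-exponents are given by `T` (normalized to `(0,0)` off `λ^{(∞)}`). -/
def IsAPSYT (μ : YoungDiagram) (T : ℕ × ℕ → ℕ) (τ : ℕ × ℕ → ℕ × ℕ) : Prop :=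
  (∀ i : ℕ, 1 ≤ i → ∃! c, cellInf μ c ∧ (τ c).1 = i) ∧
  (∀ c, cellInf μ c → 1 ≤ (τ c).1) ∧
  (∀ c : ℕ × ℕ, cellInf μ c → cellInf μ (c.1, c.2 + 1) → labelLT (τ c) (τ (c.1, c.2 + 1))) ∧
  (∀ c : ℕ × ℕ, cellInf μ c → cellInf μ (c.1 + 1, c.2) → labelLT (τ c) (τ (c.1 + 1, c.2))) ∧
  {c : ℕ × ℕ | cellInf μ c ∧ (τ c).2 ≠ 0}.Finite ∧
  (∀ c, cellInf μ c → (τ c).2 = T c) ∧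
  (∀ c, ¬ cellInf μ c → τ c = (0, 0))

/-- The rank `rk(τ)`: the least `n ≥ n_λ` such that the boxes of `λ^{(∞)} ∖ λ^{(n)}`,
read left to right, carry the consecutive labels `(n+1)·q⁰, (n+2)·q⁰, …`. -/
noncomputable def rkTab (μ : YoungDiagram) (τ : ℕ × ℕ → ℕ × ℕ) : ℕ :=
  sInf {n | nLam μ ≤ n ∧ ∀ k : ℕ, τ (0, n - μ.card + k) = (n + 1 + k, 0)}

/-- The set `Inv(τ)` of inversion pairs of `τ ∈ APSYT(λ;T)`. -/
def invSetInf (μ : YoungDiagram) (T : ℕ × ℕ → ℕ) (τ : ℕ × ℕ → ℕ × ℕ) :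
    Set ((ℕ × ℕ) × (ℕ × ℕ)) :=
  {p | cellInf μ p.1 ∧ cellInf μ p.2 ∧ boxLT T p.1 p.2 ∧ (τ p.2).1 < (τ p.1).1}

/-- `inv(τ) = |Inv(τ)|`. -/
noncomputable def invNumInf (μ : YoungDiagram) (T : ℕ × ℕ → ℕ) (τ : ℕ × ℕ → ℕ × ℕ) : ℕ :=
  (invSetInf μ T τ).ncard

/-- Row-standard reading order on boxes. -/
def rowReadLT (c c' : ℕ × ℕ) : Prop := c.1 < c'.1 ∨ (c.1 = c'.1 ∧ c.2 < c'.2)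

/-- The set `Inv(τ)` of inversion pairs (finite diagram version). -/
noncomputable def invSet (s : Finset (ℕ × ℕ)) (T : ℕ × ℕ → ℕ) (τ : ℕ × ℕ → ℕ × ℕ) :
    Finset ((ℕ × ℕ) × (ℕ × ℕ)) :=
  (s ×ˢ s).filter fun p => boxLT T p.1 p.2 ∧ (τ p.2).1 < (τ p.1).1

/-- The auxiliary reading order used to define `Min(T)`. -/
def minOrd (T : ℕ × ℕ → ℕ) (c c' : ℕ × ℕ) : Prop :=
  T c < T c' ∨ (T c = T c' ∧ rowReadLT c c')

/-- The tableau `Min(T) ∈ PSYT(λ;T)`. -/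
noncomputable def minTab (s : Finset (ℕ × ℕ)) (T : ℕ × ℕ → ℕ) : ℕ × ℕ → ℕ × ℕ :=
  fun c => if c ∈ s then ((s.filter fun c' => minOrd T c' c).card + 1, T c) else (0, 0)

/-- The position of the box `c` within its maximal run of contiguous boxes in its row
sharing a common `T`-value. -/
noncomputable def runPos (s : Finset (ℕ × ℕ)) (T : ℕ × ℕ → ℕ) (c : ℕ × ℕ) : ℕ :=
  ((Finset.range (c.2 + 1)).filter fun l =>
    ∀ m, l ≤ m → m ≤ c.2 → ((c.1, m) ∈ s ∧ T (c.1, m) = T c)).card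

/-- `[μ(T)]_t!`. -/
noncomputable def muFact {F : Type*} [Field F] (t : F) (s : Finset (ℕ × ℕ))
    (T : ℕ × ℕ → ℕ) : F :=
  ∏ c ∈ s, (1 - t ^ runPos s T c) / (1 - t)

/-- The cell set of the padded partition `λ^{(m)} = (m − |λ|, λ₁, …, λ_r)`. -/
def hatCells (μ : YoungDiagram) (m : ℕ) : Finset (ℕ × ℕ) :=
  ((Finset.range (m - μ.card)).image fun j => (0, j)) ∪
    (μ.cells.image fun c => (c.1 + 1, c.2))

/-- The restriction `T|_{λ^{(n)}}` of a labelling of `λ^{(∞)}` (normalized to `0` off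
`λ^{(n)}`). -/
noncomputable def restLam (μ : YoungDiagram) (n : ℕ) (T : ℕ × ℕ → ℕ) : ℕ × ℕ → ℕ :=
  fun c => if cellN μ n c then T c else 0

/-- The field `K = ℚ(q)((t))` of formal Laurent series in `t` over `ℚ(q)`. -/
abbrev LK : Type := LaurentSeries (RatFunc ℚ)

/-- The element `q` of `K = ℚ(q)((t))`. -/
noncomputable def qL : LK := HahnSeries.C (RatFunc.X : RatFunc ℚ)

/-- The element `t` of `K = ℚ(q)((t))`. -/
noncomputable def tL : LK := HahnSeries.single (1 : ℤ) (1 : RatFunc ℚ)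

theorem tL_ne_zero : tL ≠ 0 := HahnSeries.single_ne_zero one_ne_zero

theorem qL_ne_zero : qL ≠ 0 := by
  simp [qL, RatFunc.X_ne_zero]

theorem qL_zpow_mul_tL_zpow (a d : ℤ) :
    qL ^ a * tL ^ d = HahnSeries.single d ((RatFunc.X : RatFunc ℚ) ^ a) := by
  rw [qL, tL, ← map_zpow₀, ← RatFunc.single_zpow, HahnSeries.C_apply,
    HahnSeries.single_mul_single, zero_add, mul_one]

theorem ratFunc_X_zpow_injective : Function.Injective fun a : ℤ => (RatFunc.X : RatFunc ℚ) ^ a := by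
  have hdeg_nat : ∀ n : ℕ, RatFunc.intDegree ((RatFunc.X : RatFunc ℚ) ^ n) = n := by
    intro n
    induction n with
    | zero => simp
    | succ n ih =>
      rw [pow_succ, RatFunc.intDegree_mul (pow_ne_zero _ RatFunc.X_ne_zero) RatFunc.X_ne_zero, ih,
        RatFunc.intDegree_X]
      push_cast; rfl
  have hdeg_int : ∀ a : ℤ, RatFunc.intDegree ((RatFunc.X : RatFunc ℚ) ^ a) = a := by
    intro a
    obtain ⟨n, rfl | rfl⟩ := a.eq_nat_or_neg
    · rw [zpow_natCast, hdeg_nat]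
    · rw [zpow_neg, zpow_natCast, RatFunc.intDegree_inv, hdeg_nat]
  intro a b h
  simpa [hdeg_int] using congrArg RatFunc.intDegree h

theorem qL_zpow_mul_tL_zpow_inj {a b d e : ℤ} (h : qL ^ a * tL ^ d = qL ^ b * tL ^ e) :
    a = b ∧ d = e := by
  rw [qL_zpow_mul_tL_zpow, qL_zpow_mul_tL_zpow] at h
  have hne : ∀ a : ℤ, (RatFunc.X : RatFunc ℚ) ^ a ≠ 0 := fun a => zpow_ne_zero _ RatFunc.X_ne_zero
  have hde : d = e := by
    by_contra hde
    have := congrArg (fun f => HahnSeries.coeff f d) h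
    simp only [HahnSeries.coeff_single_same, HahnSeries.coeff_single_of_ne hde] at this
    exact hne a this
  subst hde
  exact ⟨ratFunc_X_zpow_injective (HahnSeries.single_injective _ h), rfl⟩

open WithZero in
theorem valuation_qL_zpow_mul_tL_zpow_le (a d : ℤ) :
    Valued.v (qL ^ a * tL ^ d) ≤ (exp (-d) : ℤᵐ⁰) := by
  rw [qL_zpow_mul_tL_zpow, LaurentSeries.valuation_le_iff_coeff_lt_eq_zero]
  intro n hn
  exact HahnSeries.coeff_single_of_ne hn.ne

open WithZero in
theorem valuation_tL : Valued.v tL = (exp (-1) : ℤᵐ⁰) :=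
  LaurentSeries.valuation_single_zpow (RatFunc ℚ) 1

open WithZero in
theorem valuation_tL_lt_one : Valued.v tL < (1 : ℤᵐ⁰) := by
  rw [valuation_tL, ← exp_zero, exp_lt_exp]; norm_num

open WithZero in
theorem laurent_mem_nhds {s : Set LK} {x : LK} :
    s ∈ nhds x ↔ ∃ D : ℕ, {y : LK | Valued.v (y - x) ≤ (exp (-(D : ℤ)) : ℤᵐ⁰)} ⊆ s := by
  rw [Valued.mem_nhds]
  constructor
  · rintro ⟨γ, hγ⟩
    have h0 : MonoidWithZeroHom.ValueGroup₀.embedding γ.1 ≠ (0 : ℤᵐ⁰) := by simp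
    refine ⟨(1 - log (MonoidWithZeroHom.ValueGroup₀.embedding γ.1)).toNat, fun y hy => hγ ?_⟩
    rw [Set.mem_ofPred_eq, Valuation.restrict_lt_iff_lt_embedding]
    refine lt_of_le_of_lt hy ?_
    rw [← exp_log h0, exp_lt_exp]
    simp only [log_exp]
    omega
  · rintro ⟨D, hD⟩
    have hv : Valued.v (tL ^ D) = (exp (-(D : ℤ)) : ℤᵐ⁰) := by
      rw [map_pow, valuation_tL, ← exp_nsmul]; simp
    refine ⟨Units.mk0 (Valued.v.restrict (tL ^ D)) ?_, fun y hy => hD ?_⟩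
    · rw [Ne, Valuation.restrict_eq_zero_iff, hv]; exact exp_ne_zero
    · have := (Valuation.restrict_lt_iff _).1 (show _ < Valued.v.restrict (tL ^ D) from hy)
      rw [hv] at this
      exact this.le

open WithZero in
theorem tendsto_tL_pow : Filter.Tendsto (fun n : ℕ => tL ^ n) Filter.atTop (nhds 0) := by
  intro s hs
  obtain ⟨D, hD⟩ := laurent_mem_nhds.1 hs
  refine Filter.mem_map.2 (Filter.mem_atTop_sets.2 ⟨D, fun n hn => hD ?_⟩)
  rw [Set.mem_ofPred_eq, sub_zero, map_pow, valuation_tL, ← exp_nsmul, exp_le_exp]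
  simpa using hn

theorem one_sub_tL_pow_ne_zero {k : ℕ} (hk : k ≠ 0) : 1 - tL ^ k ≠ 0 := by
  intro h
  have : Valued.v (tL ^ k) < (1 : WithZero (Multiplicative ℤ)) := by
    rw [map_pow]; exact pow_lt_one₀ zero_le valuation_tL_lt_one hk
  rw [← sub_eq_zero.1 h, map_one] at this
  exact lt_irrefl _ this

theorem tL_ne_one : tL ≠ 1 := fun h =>
  one_sub_tL_pow_ne_zero one_ne_zero (by rw [pow_one, h, sub_self])

open WithZero in
theorem hasSum_of_exhaustion {ι : Type*} (f : ι → LK) (L : LK) (F : ℕ → Finset ι)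
    (hlim : Filter.Tendsto (fun n => ∑ i ∈ F n, f i) Filter.atTop (nhds L))
    (hsmall : ∀ D : ℕ, ∀ᶠ n in Filter.atTop, ∀ i ∉ F n,
      Valued.v (f i) ≤ (exp (-(D : ℤ)) : ℤᵐ⁰)) : HasSum f L := by
  intro s hs
  rw [SummationFilter.unconditional_filter]
  obtain ⟨D, hD⟩ := laurent_mem_nhds.1 hs
  have h1 := hlim.eventually (laurent_mem_nhds.2 ⟨D, subset_rfl⟩)
  obtain ⟨n, hn1, hn2⟩ := (h1.and (hsmall D)).exists
  refine Filter.mem_map.2 (Filter.mem_atTop_sets.2 ⟨F n, fun S hS => hD ?_⟩)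
  change Valued.v (∑ i ∈ S, f i - L) ≤ _
  rw [← Finset.sum_sdiff hS, add_sub_assoc]
  refine (Valuation.map_add _ _ _).trans (max_le ?_ hn1)
  exact Valuation.map_sum_le _ fun i hi => hn2 i (Finset.mem_sdiff.1 hi).2

theorem cellInf_of_le {μ : YoungDiagram} {i j i' j' : ℕ} (h : cellInf μ (i, j)) (hi : i' ≤ i)
    (hj : j' ≤ j) : cellInf μ (i', j') := by
  cases i' with
  | zero => trivial
  | succ i' =>
    obtain ⟨i, rfl⟩ : ∃ k, i = k + 1 := ⟨i - 1, by omega⟩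
    exact μ.up_left_mem (by omega) hj h

theorem IsOmega.row_le {μ : YoungDiagram} {T : ℕ × ℕ → ℕ} (hT : IsOmega μ T) {i j j' : ℕ}
    (h : cellInf μ (i, j')) (hj : j ≤ j') : T (i, j') ≤ T (i, j) := by
  induction j', hj using Nat.le_induction with
  | base => exact le_rfl
  | succ k hk ih =>
    have hk' := cellInf_of_le h le_rfl (Nat.le_succ k)
    exact (hT.2.2.1 (i, k) hk' h).trans (ih hk')

theorem IsOmega.col_lt {μ : YoungDiagram} {T : ℕ × ℕ → ℕ} (hT : IsOmega μ T) {i i' j : ℕ}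
    (h : cellInf μ (i', j)) (hi : i < i') : T (i', j) < T (i, j) := by
  induction i', hi using Nat.le_induction with
  | base => exact hT.2.2.2 (i, j) (cellInf_of_le h (Nat.le_succ i) le_rfl) h
  | succ k hk ih =>
    have hk' := cellInf_of_le h (Nat.le_succ k) le_rfl
    exact (hT.2.2.2 (k, j) hk' h).trans (ih hk')

theorem boxLT_irrefl (T : ℕ × ℕ → ℕ) (c : ℕ × ℕ) : ¬ boxLT T c c := by
  simp [boxLT, colReadLT]

theorem boxLT_trichotomy (T : ℕ × ℕ → ℕ) {c c' : ℕ × ℕ} (h : c ≠ c') :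
    boxLT T c c' ∨ boxLT T c' c := by
  have : c.1 ≠ c'.1 ∨ c.2 ≠ c'.2 := by
    by_contra! h'
    exact h (Prod.ext h'.1 h'.2)
  unfold boxLT colReadLT
  omega

theorem boxLT_asymm {T : ℕ × ℕ → ℕ} {c c' : ℕ × ℕ} (h : boxLT T c c') : ¬ boxLT T c' c := by
  unfold boxLT colReadLT at *
  omega

theorem IsOmega.of_boxLT_of_eq {μ : YoungDiagram} {T : ℕ × ℕ → ℕ} (hT : IsOmega μ T)
    {c c' : ℕ × ℕ} (hc : cellInf μ c) (hc' : cellInf μ c') (h : boxLT T c c') (he : T c = T c') :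
    c.2 < c'.2 ∧ c'.1 ≤ c.1 := by
  obtain ⟨i, j⟩ := c
  obtain ⟨i', j'⟩ := c'
  rcases h with h | ⟨-, h⟩
  · omega
  · rcases h with h | ⟨h1, h2⟩
    · refine ⟨h, ?_⟩
      by_contra! hlt
      have h1 := hT.col_lt hc' hlt
      have h2 := hT.row_le (cellInf_of_le hc' hlt.le le_rfl) (le_of_lt h)
      simp only at h1 h2
      omega
    · simp only at h1 h2
      subst h1
      have := hT.col_lt hc' h2
      omega

theorem mem_hatCells {μ : YoungDiagram} {n : ℕ} {c : ℕ × ℕ} : c ∈ hatCells μ n ↔ cellN μ n c := by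
  obtain ⟨i, j⟩ := c
  cases i <;> simp [hatCells, cellN]

theorem cellN.cellInf {μ : YoungDiagram} {n : ℕ} {c : ℕ × ℕ} (h : cellN μ n c) : cellInf μ c := by
  obtain ⟨i, j⟩ := c
  cases i with
  | zero => trivial
  | succ i => exact h

theorem cellInf_of_mem_hatCells {μ : YoungDiagram} {n : ℕ} {c : ℕ × ℕ} (h : c ∈ hatCells μ n) :
    cellInf μ c := (mem_hatCells.1 h).cellInf

theorem card_hatCells {μ : YoungDiagram} {n : ℕ} (h : μ.card ≤ n) : (hatCells μ n).card = n := by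
  rw [hatCells, Finset.card_union_of_disjoint, Finset.card_image_of_injective,
    Finset.card_image_of_injective, Finset.card_range]
  · change n - μ.card + μ.card = n
    omega
  · rintro ⟨i, j⟩ ⟨i', j'⟩ h
    simpa using h
  · intro a b h
    simpa using h
  · rw [Finset.disjoint_left]
    rintro ⟨i, j⟩ h1 h2
    simp only [Finset.mem_image, Prod.mk.injEq] at h1 h2
    obtain ⟨_, _, h1, _⟩ := h1
    obtain ⟨_, _, h2, _⟩ := h2
    omega

theorem zero_mem_hatCells {μ : YoungDiagram} {n k : ℕ} :
    (0, k) ∈ hatCells μ n ↔ k < n - μ.card := mem_hatCells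

theorem mem_hatCells_or {μ : YoungDiagram} {c : ℕ × ℕ} (n : ℕ) (h : cellInf μ c) :
    c ∈ hatCells μ n ∨ ∃ k, n - μ.card ≤ k ∧ c = (0, k) := by
  obtain ⟨i, j⟩ := c
  cases i with
  | zero =>
    rw [zero_mem_hatCells]
    by_cases hj : j < n - μ.card
    · exact Or.inl hj
    · exact Or.inr ⟨j, by omega, rfl⟩
  | succ i => exact Or.inl (mem_hatCells.2 h)

theorem hatCells_succ {μ : YoungDiagram} {n : ℕ} (h : μ.card ≤ n) :
    hatCells μ (n + 1) = insert (0, n - μ.card) (hatCells μ n) := by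
  ext ⟨i, j⟩
  rw [Finset.mem_insert, mem_hatCells, mem_hatCells]
  cases i <;> simp [cellN]
  omega

theorem col_lt_of_mem_hatCells {μ : YoungDiagram} {n : ℕ} {c : ℕ × ℕ} (hn : nLam μ ≤ n)
    (h : c ∈ hatCells μ n) : c.2 < n - μ.card := by
  obtain ⟨i, j⟩ := c
  rw [mem_hatCells] at h
  cases i with
  | zero => exact h
  | succ i =>
    have h1 : j < μ.rowLen i := YoungDiagram.mem_iff_lt_rowLen.1 h
    have h2 := μ.rowLen_anti 0 i (Nat.zero_le i)
    unfold nLam at hn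
    simp only
    omega

theorem rkOmega_spec {μ : YoungDiagram} {T : ℕ × ℕ → ℕ} (hT : IsOmega μ T) :
    nLam μ ≤ rkOmega μ T ∧ ∀ c, cellInf μ c → ¬ cellN μ (rkOmega μ T) c → T c = 0 := by
  apply Nat.sInf_mem (s := {n | nLam μ ≤ n ∧ ∀ c, cellInf μ c → ¬ cellN μ n c → T c = 0})
  obtain ⟨b, hb⟩ := (hT.2.1.image Prod.snd).bddAbove
  refine ⟨nLam μ + b + 1, by omega, ?_⟩
  rintro ⟨i, j⟩ hc hn
  cases i with
  | succ i => exact absurd hc hn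
  | zero =>
    by_contra h0
    have : j ≤ b := hb ⟨(0, j), h0, rfl⟩
    apply hn
    change j < _
    unfold nLam
    omega

theorem card_le_rkOmega {μ : YoungDiagram} {T : ℕ × ℕ → ℕ} (hT : IsOmega μ T) :
    μ.card ≤ rkOmega μ T := by
  have := (rkOmega_spec hT).1
  unfold nLam at this
  omega

theorem restLam_rkOmega {μ : YoungDiagram} {T : ℕ × ℕ → ℕ} (hT : IsOmega μ T) :
    restLam μ (rkOmega μ T) T = T := by
  funext c
  unfold restLam
  split_ifs with h
  · rfl
  · by_cases hc : cellInf μ c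
    · exact ((rkOmega_spec hT).2 c hc h).symm
    · exact (hT.1 c hc).symm

theorem IsOmega.eq_zero_of_rk_le {μ : YoungDiagram} {T : ℕ × ℕ → ℕ} (hT : IsOmega μ T) {k : ℕ}
    (hk : rkOmega μ T - μ.card ≤ k) : T (0, k) = 0 :=
  (rkOmega_spec hT).2 (0, k) trivial (not_lt.2 hk)

theorem IsOmega.boxLT_tail {μ : YoungDiagram} {T : ℕ × ℕ → ℕ} (hT : IsOmega μ T) {n k : ℕ}
    (hn : rkOmega μ T ≤ n) (hk : n - μ.card ≤ k) {c : ℕ × ℕ} (hc : c ∈ hatCells μ n) :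
    boxLT T c (0, k) := by
  have h0 : T (0, k) = 0 := hT.eq_zero_of_rk_le (by omega)
  have h1 := col_lt_of_mem_hatCells ((rkOmega_spec hT).1.trans hn) hc
  unfold boxLT colReadLT
  simp only
  omega

/-- The variable `q^{T □} t^{c □}` attached to a box. -/
noncomputable def boxVar (T : ℕ × ℕ → ℕ) (c : ℕ × ℕ) : LK := qL ^ (T c : ℤ) * tL ^ content c

theorem boxVar_ne_zero (T : ℕ × ℕ → ℕ) (c : ℕ × ℕ) : boxVar T c ≠ 0 :=
  mul_ne_zero (zpow_ne_zero _ qL_ne_zero) (zpow_ne_zero _ tL_ne_zero)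

theorem boxVar_div (T : ℕ × ℕ → ℕ) (c c' : ℕ × ℕ) :
    qL ^ ((T c' : ℤ) - (T c : ℤ)) * tL ^ (content c' - content c) = boxVar T c' / boxVar T c := by
  rw [boxVar, boxVar, zpow_sub₀ qL_ne_zero, zpow_sub₀ tL_ne_zero, div_mul_div_comm]

theorem boxVar_sub_mul_ne_zero {μ : YoungDiagram} {T : ℕ × ℕ → ℕ} (hT : IsOmega μ T)
    {c c' : ℕ × ℕ} (hc : cellInf μ c) (hc' : cellInf μ c') (h : boxLT T c c') :
    boxVar T c - tL * boxVar T c' ≠ 0 := by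
  intro h0
  have h1 : qL ^ (T c : ℤ) * tL ^ content c = qL ^ (T c' : ℤ) * tL ^ (content c' + 1) := by
    rw [zpow_add_one₀ tL_ne_zero]
    have := sub_eq_zero.1 h0
    unfold boxVar at this
    rw [this]; ring
  obtain ⟨h2, h3⟩ := qL_zpow_mul_tL_zpow_inj h1
  have := hT.of_boxLT_of_eq hc hc' h (by exact_mod_cast h2)
  unfold content at h3
  omega

theorem boxVar_injOn {μ : YoungDiagram} {T : ℕ × ℕ → ℕ} (hT : IsOmega μ T)
    {c c' : ℕ × ℕ} (hc : cellInf μ c) (hc' : cellInf μ c') (h : boxVar T c = boxVar T c') :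
    c = c' := by
  by_contra hne
  obtain ⟨h2, h3⟩ := qL_zpow_mul_tL_zpow_inj h
  have h2 : T c = T c' := by exact_mod_cast h2
  unfold content at h3
  rcases boxLT_trichotomy T hne with h | h
  · have := hT.of_boxLT_of_eq hc hc' h h2
    omega
  · have := hT.of_boxLT_of_eq hc' hc h h2.symm
    omega

/-- Lagrange interpolation of `∏ (t z - X_j)` at the nodes `0, X_1, …, X_n`. -/
theorem sum_prod_sub_div_sub {F : Type*} [Field F] {n : ℕ} (X : Fin n → F)
    (hX : Function.Injective X) (h0 : ∀ i, X i ≠ 0) {t : F} (ht : t ≠ 0) :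
    (t - 1) * ∑ i, ∏ j ∈ Finset.univ.erase i, (t * X i - X j) / (X i - X j) = t ^ n - 1 := by
  set v : Option (Fin n) → F := fun o => o.elim 0 X with hv
  have hvs : Set.InjOn v (Finset.univ : Finset (Option (Fin n))) := by
    rintro (_ | i) - (_ | j) - h
    · rfl
    · exact absurd h.symm (h0 j)
    · exact absurd h (h0 i)
    · exact congrArg some (hX h)
  set P : Polynomial F := ∏ j, (Polynomial.C t * Polynomial.X + Polynomial.C (-X j)) with hP
  have hdeg : P.degree = n := by
    rw [hP, Polynomial.degree_prod]
    simp only [Polynomial.degree_linear ht, Finset.sum_const, Finset.card_univ, Fintype.card_fin,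
      nsmul_eq_mul, mul_one]
  have hlead : P.leadingCoeff = t ^ n := by
    rw [hP, Polynomial.leadingCoeff_prod]
    simp only [Polynomial.leadingCoeff_linear ht, Finset.prod_const, Finset.card_univ,
      Fintype.card_fin]
  have heval : ∀ x, P.eval x = ∏ j, (t * x - X j) := fun x => by
    simp [hP, Polynomial.eval_prod, sub_eq_add_neg]
  have key := Lagrange.leadingCoeff_eq_sum hvs (P := P) (by simp [hdeg])
  rw [hlead, Fintype.sum_option] at key
  have hnone : P.eval (v none) / ∏ j ∈ Finset.univ.erase none, (v none - v j) = 1 := by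
    have : (Finset.univ : Finset (Option (Fin n))).erase none = Finset.univ.map
        Function.Embedding.some := by
      ext (_ | i) <;> simp
    rw [this, Finset.prod_map, heval]
    simp only [hv, Option.elim, Function.Embedding.some_apply, mul_zero]
    exact div_self (Finset.prod_ne_zero_iff.2 fun i _ => by simpa using h0 i)
  have hsome : ∀ i : Fin n, P.eval (v (some i)) /
      ∏ j ∈ Finset.univ.erase (some i), (v (some i) - v j) =
      (t - 1) * ∏ j ∈ Finset.univ.erase i, (t * X i - X j) / (X i - X j) := by
    intro i
    have : (Finset.univ : Finset (Option (Fin n))).erase (some i) =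
        insert none ((Finset.univ.erase i).map Function.Embedding.some) := by
      ext (_ | j) <;> simp
    rw [this, Finset.prod_insert (by simp), Finset.prod_map, heval,
      ← Finset.mul_prod_erase _ _ (Finset.mem_univ i), Finset.prod_div_distrib]
    simp only [hv, Option.elim, Function.Embedding.some_apply, sub_zero]
    have h1 : ∏ j ∈ Finset.univ.erase i, (X i - X j) ≠ 0 :=
      Finset.prod_ne_zero_iff.2 fun j hj => sub_ne_zero.2 fun h =>
        (Finset.ne_of_mem_erase hj) (hX h).symm
    have := h0 i
    field_simp
  rw [hnone, Finset.sum_congr rfl fun i _ => hsome i, ← Finset.mul_sum] at key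
  rw [key]; ring

/-- The permutation of `Fin (n + 1)` sending `i` to the last element and restricting to `e` on the
complement. -/
def permOfLast {n : ℕ} (p : Fin (n + 1) × Equiv.Perm (Fin n)) : Equiv.Perm (Fin (n + 1)) :=
  ((finSuccEquiv' p.1).trans (Equiv.optionCongr p.2)).trans (finSuccEquiv' (Fin.last n)).symm

theorem permOfLast_self {n : ℕ} (i : Fin (n + 1)) (e : Equiv.Perm (Fin n)) :
    permOfLast (i, e) i = Fin.last n := by
  simp [permOfLast]

theorem permOfLast_succAbove {n : ℕ} (i : Fin (n + 1)) (e : Equiv.Perm (Fin n)) (k : Fin n) :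
    permOfLast (i, e) (i.succAbove k) = (e k).castSucc := by
  simp [permOfLast]

theorem permOfLast_bijective {n : ℕ} : Function.Bijective (permOfLast (n := n)) := by
  rw [Fintype.bijective_iff_injective_and_card]
  refine ⟨?_, ?_⟩
  · rintro ⟨i, e⟩ ⟨i', e'⟩ h
    have hi : i = i' := by
      apply (permOfLast (i, e)).injective
      rw [permOfLast_self, h, permOfLast_self]
    subst hi
    congr 1
    ext k
    have := congrArg (fun w => w (i.succAbove k)) h
    simp only [permOfLast_succAbove] at this
    simpa using congrArg Fin.val this
  · simp [Fintype.card_prod, Fintype.card_perm, Nat.factorial_succ]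

/-- The `t`-factorial `[n]_t!`. -/
noncomputable def tFact {F : Type*} [Field F] (t : F) (n : ℕ) : F :=
  ∏ k ∈ Finset.range n, (1 - t ^ (k + 1)) / (1 - t)

theorem sum_perm_prod_inversions {F : Type*} [Field F] {t : F} (ht0 : t ≠ 0) (ht1 : t ≠ 1) (n : ℕ) :
    ∀ X : Fin n → F, Function.Injective X → (∀ i, X i ≠ 0) →
      (∀ i j, i < j → X i - t * X j ≠ 0) →
      ∑ w : Equiv.Perm (Fin n), ∏ i, ∏ j, (if i < j ∧ w j < w i then
        (t * X i - X j) / (X i - t * X j) else 1) =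
      tFact t n * ∏ i, ∏ j, (if i < j then (X i - X j) / (X i - t * X j) else 1) := by
  induction n with
  | zero => intro X _ _ _; simp [tFact]
  | succ n ih =>
    intro X hX h0 hd
    have hne : ∀ {i j}, i ≠ j → X i - X j ≠ 0 := fun h => sub_ne_zero.2 fun h' => h (hX h')
    have hsplit : ∀ (G : Fin (n + 1) → Fin (n + 1) → F) (i : Fin (n + 1)), ∏ a, ∏ b, G a b =
        G i i * (∏ k, G i (i.succAbove k) * G (i.succAbove k) i) *
          ∏ k, ∏ l, G (i.succAbove k) (i.succAbove l) := by
      intro G i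
      rw [Fin.prod_univ_succAbove _ i, Fin.prod_univ_succAbove _ i]
      simp_rw [Fin.prod_univ_succAbove _ i, Finset.prod_mul_distrib]
      ring
    have hrest : ∀ i : Fin (n + 1), ∑ e : Equiv.Perm (Fin n), ∏ a, ∏ b,
        (if a < b ∧ permOfLast (i, e) b < permOfLast (i, e) a then
          (t * X a - X b) / (X a - t * X b) else 1) =
        tFact t n * (∏ k, (t * X i - X (i.succAbove k)) / (X i - X (i.succAbove k))) *
          ∏ a, ∏ b, (if a < b then (X a - X b) / (X a - t * X b) else 1) := by
      intro i
      have hi := ih (fun k => X (i.succAbove k)) (hX.comp Fin.succAbove_right_injective)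
        (fun k => h0 _) (fun k l hkl => hd _ _ (by simpa using hkl))
      simp_rw [hsplit _ i]
      simp only [permOfLast_self, permOfLast_succAbove, lt_irrefl, and_false, if_false, one_mul,
        Fin.castSucc_lt_castSucc_iff, (Fin.strictMono_succAbove i).lt_iff_lt,
        Fin.castSucc_lt_last, and_true, not_lt_of_ge (Fin.le_last _), mul_one]
      have hA : (∏ k, if i < i.succAbove k then
            (t * X i - X (i.succAbove k)) / (X i - t * X (i.succAbove k)) else 1) =
          (∏ k, (t * X i - X (i.succAbove k)) / (X i - X (i.succAbove k))) *
          ∏ k, (if i < i.succAbove k then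
            (X i - X (i.succAbove k)) / (X i - t * X (i.succAbove k)) else 1) *
            (if i.succAbove k < i then
              (X (i.succAbove k) - X i) / (X (i.succAbove k) - t * X i) else 1) := by
        rw [← Finset.prod_mul_distrib]
        refine Finset.prod_congr rfl fun k _ => ?_
        have hik : i ≠ i.succAbove k := (Fin.succAbove_ne i k).symm
        rcases lt_or_gt_of_ne hik with h | h
        · have := hne hik
          have := hd _ _ h
          simp only [h, not_lt_of_gt h, if_true, if_false]
          field_simp
        · have h1 := hne hik
          have h2 := hne hik.symm
          have := hd _ _ h
          simp only [h, not_lt_of_gt h, if_true, if_false]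
          field_simp
          ring
      rw [← Finset.mul_sum, hi, hA]
      ring
    rw [← Fintype.sum_equiv (Equiv.ofBijective _ permOfLast_bijective) _ _ (fun _ => rfl),
      Fintype.sum_prod_type]
    simp only [Equiv.ofBijective_apply]
    rw [Finset.sum_congr rfl fun i _ => hrest i, ← Finset.sum_mul, ← Finset.mul_sum]
    congr 1
    have hlag := sum_prod_sub_div_sub X hX h0 ht0
    have herase : ∀ i : Fin (n + 1), ∏ j ∈ Finset.univ.erase i, (t * X i - X j) / (X i - X j) =
        ∏ k, (t * X i - X (i.succAbove k)) / (X i - X (i.succAbove k)) := by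
      intro i
      have : Finset.univ.erase i = Finset.univ.map i.succAboveEmb := by
        ext j
        simp only [Finset.mem_erase, Finset.mem_univ, and_true, Finset.mem_map, true_and,
          Fin.coe_succAboveEmb]
        exact ⟨fun h => Fin.exists_succAbove_eq h, by rintro ⟨k, rfl⟩; exact Fin.succAbove_ne i k⟩
      rw [this, Finset.prod_map]; rfl
    simp_rw [herase] at hlag
    have h1 : 1 - t ≠ 0 := sub_ne_zero.2 ht1.symm
    rw [show tFact t (n + 1) = tFact t n * ((1 - t ^ (n + 1)) / (1 - t)) from
      Finset.prod_range_succ _ _]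
    congr 1
    rw [eq_div_iff h1]
    linear_combination -hlag

/-- The weight of an inversion, with the factor `t` absorbed. -/
noncomputable def invWeight (T : ℕ × ℕ → ℕ) (c c' : ℕ × ℕ) : LK :=
  (tL * boxVar T c - boxVar T c') / (boxVar T c - tL * boxVar T c')

/-- The factor attached to an ordered pair of boxes in the closed formula. -/
noncomputable def pairWeight (T : ℕ × ℕ → ℕ) (c c' : ℕ × ℕ) : LK :=
  (boxVar T c - boxVar T c') / (boxVar T c - tL * boxVar T c')

theorem exists_enum {T : ℕ × ℕ → ℕ} (s : Finset (ℕ × ℕ)) {n : ℕ} (hs : s.card = n) :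
    ∃ e : Fin n → ℕ × ℕ, Function.Injective e ∧ Finset.univ.image e = s ∧
      ∀ i j, i < j ↔ boxLT T (e i) (e j) := by
  let key : ℕ × ℕ → ℕᵒᵈ ×ₗ (ℕ ×ₗ ℕ) := fun c => toLex (OrderDual.toDual (T c), toLex (c.2, c.1))
  have hkey : Function.Injective key := by
    rintro ⟨i, j⟩ ⟨i', j'⟩ h
    simp only [key, EmbeddingLike.apply_eq_iff_eq, Prod.mk.injEq] at h
    exact Prod.ext h.2.2 h.2.1
  have hlt : ∀ c c', key c < key c' ↔ boxLT T c c' := by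
    intro c c'
    simp only [key, Prod.Lex.toLex_lt_toLex, OrderDual.toDual_lt_toDual, boxLT, colReadLT,
      EmbeddingLike.apply_eq_iff_eq]
  have hcard : (s.image key).card = n := by rw [Finset.card_image_of_injective _ hkey, hs]
  have hmem : ∀ i, ∃ c, c ∈ s ∧ key c = (s.image key).orderEmbOfFin hcard i := fun i =>
    Finset.mem_image.1 (Finset.orderEmbOfFin_mem _ hcard i)
  choose e he1 he2 using hmem
  have hinj : Function.Injective e := by
    intro i j h
    have := congrArg key h
    rw [he2, he2] at this
    exact (Finset.orderEmbOfFin _ hcard).injective this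
  refine ⟨e, hinj, ?_, fun i j => ?_⟩
  · apply Finset.eq_of_subset_of_card_le
    · intro c hc
      obtain ⟨i, -, rfl⟩ := Finset.mem_image.1 hc
      exact he1 i
    · rw [Finset.card_image_of_injective _ hinj, hs]; simp
  · rw [← hlt, he2, he2]
    simp

/-- The product of the pair weights over the ordered pairs of boxes of `λ^{(n)}`. -/
noncomputable def pairProd (μ : YoungDiagram) (T : ℕ × ℕ → ℕ) (n : ℕ) : LK :=
  ∏ c ∈ hatCells μ n, ∏ c' ∈ hatCells μ n, if boxLT T c c' then pairWeight T c c' else 1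

/-- The summand attached to a labelling `τ`. -/
noncomputable def tabWeight (μ : YoungDiagram) (T : ℕ × ℕ → ℕ) (τ : ℕ × ℕ → ℕ × ℕ) : LK :=
  tL ^ invNumInf μ T τ *
    ∏ᶠ p ∈ invSetInf μ T τ,
      (1 - qL ^ ((T p.2 : ℤ) - (T p.1 : ℤ)) * tL ^ (content p.2 - content p.1 - 1)) /
        (1 - qL ^ ((T p.2 : ℤ) - (T p.1 : ℤ)) * tL ^ (content p.2 - content p.1 + 1))

theorem tL_mul_div_eq_invWeight (T : ℕ × ℕ → ℕ) (c c' : ℕ × ℕ) :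
    tL * ((1 - qL ^ ((T c' : ℤ) - (T c : ℤ)) * tL ^ (content c' - content c - 1)) /
        (1 - qL ^ ((T c' : ℤ) - (T c : ℤ)) * tL ^ (content c' - content c + 1))) =
      invWeight T c c' := by
  have h0 := boxVar_ne_zero T c
  have ht := tL_ne_zero
  rw [zpow_sub_one₀ ht, zpow_add_one₀ ht, ← mul_assoc, ← mul_assoc, boxVar_div, invWeight]
  have h1 : 1 - boxVar T c' / boxVar T c * tL = (boxVar T c - tL * boxVar T c') / boxVar T c := by
    field_simp
  have h2 : tL * (1 - boxVar T c' / boxVar T c * tL⁻¹) =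
      (tL * boxVar T c - boxVar T c') / boxVar T c := by
    field_simp
  rw [← mul_div_assoc, h1, h2, div_div_div_cancel_right₀ h0]

theorem pairWeight_eq (T : ℕ × ℕ → ℕ) (c c' : ℕ × ℕ) :
    (1 - qL ^ ((T c' : ℤ) - (T c : ℤ)) * tL ^ (content c' - content c)) /
        (1 - qL ^ ((T c' : ℤ) - (T c : ℤ)) * tL ^ (content c' - content c + 1)) =
      pairWeight T c c' := by
  have h0 := boxVar_ne_zero T c
  rw [zpow_add_one₀ tL_ne_zero, ← mul_assoc, boxVar_div, pairWeight]
  have h1 : 1 - boxVar T c' / boxVar T c * tL = (boxVar T c - tL * boxVar T c') / boxVar T c := by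
    field_simp
  have h2 : 1 - boxVar T c' / boxVar T c =
      (boxVar T c - boxVar T c') / boxVar T c := by
    field_simp
  rw [h1, h2, div_div_div_cancel_right₀ h0]

theorem tabWeight_eq {μ : YoungDiagram} {T : ℕ × ℕ → ℕ} {τ : ℕ × ℕ → ℕ × ℕ}
    {S : Finset ((ℕ × ℕ) × (ℕ × ℕ))} (hS : invSetInf μ T τ = S) :
    tabWeight μ T τ = ∏ p ∈ S, invWeight T p.1 p.2 := by
  have hc : invNumInf μ T τ = S.card := by rw [invNumInf, hS, Set.ncard_coe_finset]
  rw [tabWeight, hc, hS, finprod_mem_coe_finset, ← Finset.prod_const, ← Finset.prod_mul_distrib]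
  exact Finset.prod_congr rfl fun p _ => tL_mul_div_eq_invWeight T p.1 p.2

/-- The labelling of `λ^{(∞)}` which permutes `1, …, n` on `λ^{(n)}`, enumerated by `e`, according
to `w` and is consecutive on the rest of the first row. -/
noncomputable def tabOfPerm (μ : YoungDiagram) (T : ℕ × ℕ → ℕ) {n : ℕ} (e : Fin n → ℕ × ℕ)
    (w : Equiv.Perm (Fin n)) (c : ℕ × ℕ) : ℕ × ℕ :=
  if h : ∃ i, e i = c then ((w h.choose : ℕ) + 1, T c)
  else if cellInf μ c then (c.2 + μ.card + 1, 0) else (0, 0)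

section tabOfPerm

variable {μ : YoungDiagram} {T : ℕ × ℕ → ℕ} {n : ℕ} {e : Fin n → ℕ × ℕ}

theorem tabOfPerm_enum (he : Function.Injective e) (w : Equiv.Perm (Fin n)) (i : Fin n) :
    tabOfPerm μ T e w (e i) = ((w i : ℕ) + 1, T (e i)) := by
  have h : ∃ j, e j = e i := ⟨i, rfl⟩
  rw [tabOfPerm, dif_pos h, he h.choose_spec]

theorem tabOfPerm_tail (hs : Finset.univ.image e = hatCells μ n) (w : Equiv.Perm (Fin n)) {k : ℕ}
    (hk : n - μ.card ≤ k) : tabOfPerm μ T e w (0, k) = (k + μ.card + 1, 0) := by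
  rw [tabOfPerm, dif_neg, if_pos]
  · trivial
  · rintro ⟨i, hi⟩
    have : (0, k) ∈ hatCells μ n := by rw [← hs, ← hi]; simp
    rw [zero_mem_hatCells] at this
    omega

theorem tabOfPerm_of_not_cellInf (hs : Finset.univ.image e = hatCells μ n)
    (w : Equiv.Perm (Fin n)) {c : ℕ × ℕ} (hc : ¬ cellInf μ c) :
    tabOfPerm μ T e w c = (0, 0) := by
  rw [tabOfPerm, dif_neg, if_neg hc]
  rintro ⟨i, rfl⟩
  exact hc (cellInf_of_mem_hatCells (n := n) (by rw [← hs]; simp))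

theorem enum_mem (hs : Finset.univ.image e = hatCells μ n) (i : Fin n) : e i ∈ hatCells μ n := by
  rw [← hs]; simp

theorem enum_or_tail (hs : Finset.univ.image e = hatCells μ n) {c : ℕ × ℕ} (hc : cellInf μ c) :
    (∃ i, e i = c) ∨ ∃ k, n - μ.card ≤ k ∧ c = (0, k) := by
  rcases mem_hatCells_or n hc with h | h
  · rw [← hs] at h
    simpa using Or.inl h
  · exact Or.inr h

theorem tabOfPerm_injective (he : Function.Injective e) :
    Function.Injective (tabOfPerm μ T e) := by
  intro w w' h
  ext i
  have := congrFun h (e i)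
  rw [tabOfPerm_enum he, tabOfPerm_enum he] at this
  simpa using this

theorem invSetInf_tabOfPerm (hT : IsOmega μ T) (hn : rkOmega μ T ≤ n)
    (he : Function.Injective e) (hs : Finset.univ.image e = hatCells μ n)
    (hlt : ∀ i j, i < j ↔ boxLT T (e i) (e j)) (w : Equiv.Perm (Fin n)) :
    invSetInf μ T (tabOfPerm μ T e w) =
      ((Finset.univ.filter fun p : Fin n × Fin n => p.1 < p.2 ∧ w p.2 < w p.1).image
        (Prod.map e e) : Finset _) := by
  have hcard := card_le_rkOmega hT
  ext ⟨c, c'⟩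
  simp only [invSetInf, Set.mem_ofPred_eq, Finset.coe_image, Set.mem_image, Finset.coe_filter,
    Finset.mem_univ, true_and, Prod.exists, Prod.map_apply, Prod.mk.injEq]
  constructor
  · rintro ⟨hc, hc', hb, hl⟩
    rcases enum_or_tail hs hc with ⟨i, rfl⟩ | ⟨k, hk, rfl⟩ <;>
    rcases enum_or_tail hs hc' with ⟨j, rfl⟩ | ⟨l, hl', rfl⟩
    · refine ⟨i, j, ⟨(hlt i j).2 hb, ?_⟩, rfl, rfl⟩
      rw [tabOfPerm_enum he, tabOfPerm_enum he] at hl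
      simpa using hl
    · rw [tabOfPerm_enum he, tabOfPerm_tail hs w hl'] at hl
      have := (w i).2
      simp only at hl
      omega
    · exact absurd hb (boxLT_asymm (hT.boxLT_tail hn hk (enum_mem hs j)))
    · rw [tabOfPerm_tail hs w hk, tabOfPerm_tail hs w hl'] at hl
      have h1 : T (0, k) = 0 := hT.eq_zero_of_rk_le (by omega)
      have h2 : T (0, l) = 0 := hT.eq_zero_of_rk_le (by omega)
      simp only [boxLT, colReadLT, h1, h2] at hb hl
      omega
  · rintro ⟨i, j, ⟨hij, hw⟩, rfl, rfl⟩
    refine ⟨cellInf_of_mem_hatCells (enum_mem hs i), cellInf_of_mem_hatCells (enum_mem hs j),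
      (hlt i j).1 hij, ?_⟩
    rw [tabOfPerm_enum he, tabOfPerm_enum he]
    simpa using hw

theorem tabWeight_tabOfPerm (hT : IsOmega μ T) (hn : rkOmega μ T ≤ n)
    (he : Function.Injective e) (hs : Finset.univ.image e = hatCells μ n)
    (hlt : ∀ i j, i < j ↔ boxLT T (e i) (e j)) (w : Equiv.Perm (Fin n)) :
    tabWeight μ T (tabOfPerm μ T e w) =
      ∏ i, ∏ j, if i < j ∧ w j < w i then invWeight T (e i) (e j) else 1 := by
  rw [tabWeight_eq (invSetInf_tabOfPerm hT hn he hs hlt w),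
    Finset.prod_image (he.prodMap he).injOn, Finset.prod_filter, Fintype.prod_prod_type]
  rfl

theorem sum_tabWeight_tabOfPerm (hT : IsOmega μ T) (hn : rkOmega μ T ≤ n)
    (he : Function.Injective e) (hs : Finset.univ.image e = hatCells μ n)
    (hlt : ∀ i j, i < j ↔ boxLT T (e i) (e j)) :
    ∑ w, tabWeight μ T (tabOfPerm μ T e w) = tFact tL n * pairProd μ T n := by
  have hcell : ∀ i, cellInf μ (e i) := fun i => cellInf_of_mem_hatCells (enum_mem hs i)
  simp_rw [tabWeight_tabOfPerm hT hn he hs hlt]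
  refine (sum_perm_prod_inversions tL_ne_zero tL_ne_one n (fun i => boxVar T (e i))
    (fun i j h => he (boxVar_injOn hT (hcell i) (hcell j) h)) (fun i => boxVar_ne_zero _ _)
    (fun i j h => boxVar_sub_mul_ne_zero hT (hcell i) (hcell j) ((hlt i j).1 h))).trans ?_
  rw [pairProd, ← hs, Finset.prod_image he.injOn]
  simp_rw [Finset.prod_image he.injOn, hlt]
  rfl

/-- A labelling `tabOfPerm` fails to be an APSYT only by decreasing along a constant run of `T`,
and then its weight vanishes. -/
theorem isAPSYT_tabOfPerm_or (hT : IsOmega μ T) (hn : rkOmega μ T ≤ n)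
    (he : Function.Injective e) (hs : Finset.univ.image e = hatCells μ n)
    (hlt : ∀ i j, i < j ↔ boxLT T (e i) (e j)) (w : Equiv.Perm (Fin n)) :
    IsAPSYT μ T (tabOfPerm μ T e w) ∨ tabWeight μ T (tabOfPerm μ T e w) = 0 := by
  rw [or_iff_not_imp_right]
  intro hW
  have hcard := card_le_rkOmega hT
  set τ := tabOfPerm μ T e w with hτ
  have hsnd : ∀ c, cellInf μ c → (τ c).2 = T c := by
    intro c hc
    rcases enum_or_tail hs hc with ⟨i, rfl⟩ | ⟨k, hk, rfl⟩
    · rw [hτ, tabOfPerm_enum he]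
    · rw [hτ, tabOfPerm_tail hs w hk, hT.eq_zero_of_rk_le (by omega)]
  have hinj : ∀ c c', cellInf μ c → cellInf μ c' → (τ c).1 = (τ c').1 → c = c' := by
    intro c c' hc hc' h
    rcases enum_or_tail hs hc with ⟨i, rfl⟩ | ⟨k, hk, rfl⟩ <;>
    rcases enum_or_tail hs hc' with ⟨j, rfl⟩ | ⟨l, hl, rfl⟩
    · rw [hτ, tabOfPerm_enum he, tabOfPerm_enum he] at h
      have : w i = w j := Fin.ext (by simpa using h)
      rw [w.injective this]
    · rw [hτ, tabOfPerm_enum he, tabOfPerm_tail hs w hl] at h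
      have := (w i).2
      simp only at h
      omega
    · rw [hτ, tabOfPerm_enum he, tabOfPerm_tail hs w hk] at h
      have := (w j).2
      simp only at h
      omega
    · rw [hτ, tabOfPerm_tail hs w hk, tabOfPerm_tail hs w hl] at h
      simp only at h
      have : k = l := by omega
      rw [this]
  refine ⟨?_, ?_, ?_, ?_, ?_, hsnd, fun c hc => tabOfPerm_of_not_cellInf hs w hc⟩
  · intro m hm
    have hex : ∃ c, cellInf μ c ∧ (τ c).1 = m := by
      by_cases hmn : m ≤ n
      · refine ⟨e (w.symm ⟨m - 1, by omega⟩), cellInf_of_mem_hatCells (enum_mem hs _), ?_⟩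
        rw [hτ, tabOfPerm_enum he]
        simp only [Equiv.apply_symm_apply]
        omega
      · refine ⟨(0, m - μ.card - 1), trivial, ?_⟩
        rw [hτ, tabOfPerm_tail hs w (by omega)]
        simp only
        omega
    obtain ⟨c, hc, hcm⟩ := hex
    exact ⟨c, ⟨hc, hcm⟩, fun c' h => hinj _ _ h.1 hc (h.2.trans hcm.symm)⟩
  · intro c hc
    rcases enum_or_tail hs hc with ⟨i, rfl⟩ | ⟨k, hk, rfl⟩
    · rw [hτ, tabOfPerm_enum he]; simp
    · rw [hτ, tabOfPerm_tail hs w hk]; simp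
  · rintro ⟨i, j⟩ hc hc'
    unfold labelLT
    rw [hsnd _ hc, hsnd _ hc']
    rcases (hT.row_le hc' (Nat.le_succ j)).lt_or_eq with h | h
    · exact Or.inl h
    · refine Or.inr ⟨h.symm, ?_⟩
      by_contra! hle
      apply hW
      have hS := invSetInf_tabOfPerm hT hn he hs hlt w
      rw [tabWeight_eq hS]
      have hmem : ((i, j), (i, j + 1)) ∈ invSetInf μ T τ := by
        refine ⟨hc, hc', Or.inr ⟨h.symm, Or.inl (Nat.lt_succ_self j)⟩, lt_of_le_of_ne hle ?_⟩
        intro h'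
        have := congrArg Prod.snd (hinj _ _ hc' hc h')
        simp at this
      rw [hτ, hS] at hmem
      refine Finset.prod_eq_zero hmem ?_
      have hcont : content (i, j + 1) = content (i, j) + 1 := by
        simp only [content]; push_cast; ring
      have : boxVar T (i, j + 1) = tL * boxVar T (i, j) := by
        rw [boxVar, boxVar, hcont, zpow_add_one₀ tL_ne_zero, h]
        ring
      rw [invWeight, this, sub_self, zero_div]
  · rintro ⟨i, j⟩ hc hc'
    left
    rw [hsnd _ hc, hsnd _ hc']
    exact hT.col_lt hc' (Nat.lt_succ_self i)
  · refine hT.2.1.subset ?_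
    rintro c ⟨hc, h⟩
    rwa [hsnd c hc] at h

theorem IsAPSYT.exists_perm (hT : IsOmega μ T) (hn : rkOmega μ T ≤ n)
    (he : Function.Injective e) (hs : Finset.univ.image e = hatCells μ n)
    {τ : ℕ × ℕ → ℕ × ℕ} (hτ : IsAPSYT μ T τ)
    (htail : ∀ k, n - μ.card ≤ k → (τ (0, k)).1 = k + μ.card + 1) :
    ∃ w, tabOfPerm μ T e w = τ := by
  have hcard := card_le_rkOmega hT
  have hcell : ∀ i, cellInf μ (e i) := fun i => cellInf_of_mem_hatCells (enum_mem hs i)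
  have hpos : ∀ i, 1 ≤ (τ (e i)).1 := fun i => hτ.2.1 _ (hcell i)
  have hle : ∀ i, (τ (e i)).1 - 1 < n := by
    intro i
    by_contra! h
    have h1 := htail ((τ (e i)).1 - 1 - μ.card) (by omega)
    have h2 := (hτ.1 _ (hpos i)).unique ⟨hcell i, rfl⟩
      (show cellInf μ (0, (τ (e i)).1 - 1 - μ.card) ∧ _ from
        ⟨trivial, by rw [h1]; have := hpos i; omega⟩)
    have h3 := enum_mem hs i
    rw [h2, zero_mem_hatCells] at h3
    omega
  let f : Fin n → Fin n := fun i => ⟨(τ (e i)).1 - 1, hle i⟩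
  have hf : Function.Injective f := by
    intro i j h
    have h1 : (τ (e i)).1 - 1 = (τ (e j)).1 - 1 := congrArg Fin.val h
    have h2 : (τ (e j)).1 = (τ (e i)).1 := by have := hpos i; have := hpos j; omega
    exact he ((hτ.1 _ (hpos i)).unique ⟨hcell i, rfl⟩ ⟨hcell j, h2⟩)
  refine ⟨Equiv.ofBijective f (Finite.injective_iff_bijective.1 hf), ?_⟩
  funext c
  by_cases hc : cellInf μ c
  · rcases enum_or_tail hs hc with ⟨i, rfl⟩ | ⟨k, hk, rfl⟩
    · rw [tabOfPerm_enum he]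
      refine Prod.ext ?_ (hτ.2.2.2.2.2.1 _ hc).symm
      change (τ (e i)).1 - 1 + 1 = (τ (e i)).1
      have := hpos i; omega
    · rw [tabOfPerm_tail hs _ hk]
      refine Prod.ext (htail k hk).symm ?_
      rw [hτ.2.2.2.2.2.1 _ hc, hT.eq_zero_of_rk_le (by omega)]
  · rw [tabOfPerm_of_not_cellInf hs _ hc, hτ.2.2.2.2.2.2 c hc]

end tabOfPerm

section APSYT

variable {μ : YoungDiagram} {T : ℕ × ℕ → ℕ} {τ : ℕ × ℕ → ℕ × ℕ}

theorem IsAPSYT.label_injective (hτ : IsAPSYT μ T τ) {c c' : ℕ × ℕ} (hc : cellInf μ c)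
    (hc' : cellInf μ c') (h : (τ c).1 = (τ c').1) : c = c' :=
  (hτ.1 _ (hτ.2.1 c hc)).unique ⟨hc, rfl⟩ ⟨hc', h.symm⟩

theorem IsAPSYT.tail_strictMono (hT : IsOmega μ T) (hτ : IsAPSYT μ T τ) {k l : ℕ}
    (hk : rkOmega μ T - μ.card ≤ k) (hkl : k < l) : (τ (0, k)).1 < (τ (0, l)).1 := by
  have hstep : ∀ m, k ≤ m → (τ (0, m)).1 < (τ (0, m + 1)).1 := by
    intro m hm
    have h1 := hτ.2.2.1 (0, m) trivial trivial
    unfold labelLT at h1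
    rw [hτ.2.2.2.2.2.1 (0, m) trivial, hτ.2.2.2.2.2.1 (0, m + 1) trivial,
      hT.eq_zero_of_rk_le (by omega), hT.eq_zero_of_rk_le (by omega)] at h1
    simpa using h1
  induction l, hkl using Nat.le_induction with
  | base => exact hstep k le_rfl
  | succ m hm ih => exact ih.trans (hstep m (by omega))

theorem IsAPSYT.fst_mem_of_mem_invSetInf (hT : IsOmega μ T) (hτ : IsAPSYT μ T τ)
    {p : (ℕ × ℕ) × (ℕ × ℕ)} (hp : p ∈ invSetInf μ T τ) : p.1 ∈ hatCells μ (rkOmega μ T) := by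
  obtain ⟨c, c'⟩ := p
  obtain ⟨hc, hc', hb, hl⟩ := hp
  rcases mem_hatCells_or (rkOmega μ T) hc with h | ⟨k, hk, rfl⟩
  · exact h
  · rcases mem_hatCells_or (rkOmega μ T) hc' with h | ⟨l, hl', rfl⟩
    · exact absurd hb (boxLT_asymm (hT.boxLT_tail le_rfl hk h))
    · have h1 := hT.eq_zero_of_rk_le hk
      have h2 := hT.eq_zero_of_rk_le hl'
      simp only [boxLT, colReadLT, h1, h2] at hb
      have := hτ.tail_strictMono hT hk (show k < l by omega)
      simp only at hl
      omega

theorem IsAPSYT.finite_invSetInf (hT : IsOmega μ T) (hτ : IsAPSYT μ T τ) :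
    (invSetInf μ T τ).Finite := by
  have hfin : ∀ m : ℕ, {c | cellInf μ c ∧ (τ c).1 < m}.Finite := by
    intro m
    refine Set.Finite.of_finite_image ((Set.finite_lt_nat m).subset ?_)
      (f := fun c => (τ c).1) ?_
    · rintro _ ⟨c, hc, rfl⟩
      exact hc.2
    · intro c hc c' hc' h
      exact hτ.label_injective hc.1 hc'.1 h
  refine (((hatCells μ (rkOmega μ T)).finite_toSet).biUnion fun c _ =>
    (hfin (τ c).1).image (Prod.mk c)).subset ?_
  rintro ⟨c, c'⟩ hp
  refine Set.mem_biUnion (hτ.fst_mem_of_mem_invSetInf hT hp) ?_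
  exact ⟨c', ⟨hp.2.1, hp.2.2.2⟩, rfl⟩

theorem IsAPSYT.le_invNumInf (hT : IsOmega μ T) (hτ : IsAPSYT μ T τ) {n k : ℕ}
    (hn : rkOmega μ T ≤ n) (hk : n - μ.card ≤ k) (hne : (τ (0, k)).1 ≠ k + μ.card + 1) :
    n - rkOmega μ T ≤ invNumInf μ T τ := by
  set r := rkOmega μ T with hr
  have hcard : μ.card ≤ r := card_le_rkOmega hT
  obtain ⟨c, hc, hlc⟩ : ∃ c ∈ hatCells μ r, (τ (0, k)).1 < (τ c).1 := by
    by_contra! hcon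
    apply hne
    have himage : (hatCells μ (k + μ.card)).image (fun c => (τ c).1) =
        Finset.Ico 1 (τ (0, k)).1 := by
      ext m
      simp only [Finset.mem_image, Finset.mem_Ico]
      constructor
      · rintro ⟨c, hc, rfl⟩
        have hcell := cellInf_of_mem_hatCells hc
        refine ⟨hτ.2.1 c hcell, ?_⟩
        rcases mem_hatCells_or r hcell with h | ⟨l, hl, rfl⟩
        · refine lt_of_le_of_ne (hcon c h) fun h' => ?_
          have := hτ.label_injective hcell (show cellInf μ (0, k) from trivial) h'
          rw [this, zero_mem_hatCells] at h
          omega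
        · rw [zero_mem_hatCells] at hc
          exact hτ.tail_strictMono hT hl (by omega)
      · rintro ⟨hm1, hm2⟩
        obtain ⟨c, ⟨hc, hcm⟩, -⟩ := hτ.1 m hm1
        refine ⟨c, ?_, hcm⟩
        rcases mem_hatCells_or (k + μ.card) hc with h | ⟨l, hl, rfl⟩
        · exact h
        · exfalso
          have hkl : k ≤ l := by omega
          rcases hkl.eq_or_lt with rfl | hkl
          · omega
          · have := hτ.tail_strictMono hT (show r - μ.card ≤ k by omega) hkl
            omega
    have hcards := congrArg Finset.card himage
    rw [Finset.card_image_of_injOn, card_hatCells (by omega), Nat.card_Ico] at hcards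
    · have := hτ.2.1 (0, k) trivial
      omega
    · intro c hc c' hc' h
      exact hτ.label_injective (cellInf_of_mem_hatCells hc) (cellInf_of_mem_hatCells hc') h
  have hsub : (((Finset.Icc (r - μ.card) k).image fun l => (c, ((0, l) : ℕ × ℕ)) :
      Finset _) : Set ((ℕ × ℕ) × (ℕ × ℕ))) ⊆ invSetInf μ T τ := by
    intro p hp
    obtain ⟨l, hl, rfl⟩ := Finset.mem_image.1 (Finset.mem_coe.1 hp)
    rw [Finset.mem_Icc] at hl
    refine ⟨cellInf_of_mem_hatCells hc, trivial, hT.boxLT_tail le_rfl hl.1 hc, ?_⟩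
    refine lt_of_le_of_lt ?_ hlc
    rcases hl.2.eq_or_lt with rfl | h
    · exact le_rfl
    · exact (hτ.tail_strictMono hT hl.1 h).le
  have := Set.ncard_le_ncard hsub (hτ.finite_invSetInf hT)
  rw [Set.ncard_coe_finset, Finset.card_image_of_injective _ (fun a b h => by simpa using h),
    Nat.card_Icc] at this
  unfold invNumInf
  omega

open WithZero in
theorem valuation_invWeight_le {c c' : ℕ × ℕ} (h : content c + 1 ≤ content c') :
    Valued.v (invWeight T c c') ≤ (exp (-1) : ℤᵐ⁰) := by
  have hx : Valued.v (boxVar T c' / boxVar T c) ≤ (exp (-1) : ℤᵐ⁰) := by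
    rw [← boxVar_div]
    refine (valuation_qL_zpow_mul_tL_zpow_le _ _).trans ?_
    rw [exp_le_exp]; omega
  have ht : Valued.v tL ≤ (exp (-1) : ℤᵐ⁰) := valuation_tL.le
  have hlt : (exp (-1) : ℤᵐ⁰) < 1 := by rw [← exp_zero, exp_lt_exp]; norm_num
  have h0 := boxVar_ne_zero T c
  have heq : invWeight T c c' = (tL - boxVar T c' / boxVar T c) /
      (1 - tL * (boxVar T c' / boxVar T c)) := by
    have h1 : tL - boxVar T c' / boxVar T c =
        (tL * boxVar T c - boxVar T c') / boxVar T c := by field_simp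
    have h2 : 1 - tL * (boxVar T c' / boxVar T c) =
        (boxVar T c - tL * boxVar T c') / boxVar T c := by field_simp
    rw [h1, h2, div_div_div_cancel_right₀ h0, invWeight]
  have hden : Valued.v (1 - tL * (boxVar T c' / boxVar T c)) = (1 : ℤᵐ⁰) := by
    apply Valuation.map_one_sub_of_lt
    rw [map_mul]
    exact mul_lt_one_of_nonneg_of_lt_one_left zero_le (ht.trans_lt hlt) (hx.trans hlt.le)
  rw [heq, map_div₀, hden, div_one]
  exact (Valuation.map_sub _ _ _).trans (max_le ht hx)

open WithZero in
theorem exists_valuation_tabWeight_le (hT : IsOmega μ T) :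
    ∃ C : ℕ, ∀ τ, IsAPSYT μ T τ →
      Valued.v (tabWeight μ T τ) ≤ (exp ((C : ℤ) - invNumInf μ T τ) : ℤᵐ⁰) := by
  set r := rkOmega μ T with hr
  set E := hatCells μ r ×ˢ hatCells μ r with hE
  have hbound : ∀ p : (ℕ × ℕ) × (ℕ × ℕ), ∃ m : ℕ,
      Valued.v (invWeight T p.1 p.2) ≤ (exp ((m : ℤ) - 1) : ℤᵐ⁰) := by
    intro p
    by_cases h0 : Valued.v (invWeight T p.1 p.2) = (0 : ℤᵐ⁰)
    · exact ⟨0, by rw [h0]; exact zero_le⟩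
    · refine ⟨(log (Valued.v (invWeight T p.1 p.2) : ℤᵐ⁰) + 1).toNat, ?_⟩
      nth_rewrite 1 [← exp_log h0]
      rw [exp_le_exp]
      omega
  choose B hB using hbound
  refine ⟨∑ p ∈ E, B p, fun τ hτ => ?_⟩
  set S := (hτ.finite_invSetInf hT).toFinset with hS
  have hSc : invSetInf μ T τ = S := by simp [hS]
  have hnum : invNumInf μ T τ = S.card := by rw [invNumInf, hSc, Set.ncard_coe_finset]
  have hle : ∀ p ∈ S, Valued.v (invWeight T p.1 p.2) ≤
      (exp (((if p ∈ E then B p else 0 : ℕ) : ℤ) - 1) : ℤᵐ⁰) := by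
    intro p hp
    split_ifs with h
    · exact hB p
    · have hp' : p ∈ invSetInf μ T τ := by rw [hSc]; exact hp
      have h1 := hτ.fst_mem_of_mem_invSetInf hT hp'
      obtain ⟨c, c'⟩ := p
      have h2 : c' ∉ hatCells μ r := fun h2 => h (Finset.mem_product.2 ⟨h1, h2⟩)
      obtain ⟨k, hk, rfl⟩ := (mem_hatCells_or r hp'.2.1).resolve_left h2
      have h3 := col_lt_of_mem_hatCells (rkOmega_spec hT).1 h1
      simpa using valuation_invWeight_le (T := T) (c := c) (c' := (0, k)) (by
        unfold content
        simp only at *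
        omega)
  have hexp : ∀ (U : Finset ((ℕ × ℕ) × (ℕ × ℕ))) (f : (ℕ × ℕ) × (ℕ × ℕ) → ℤ),
      ∏ p ∈ U, (exp (f p) : ℤᵐ⁰) = exp (∑ p ∈ U, f p) := by
    intro U f
    induction U using Finset.induction_on with
    | empty => simp
    | insert a U ha ih => rw [Finset.prod_insert ha, Finset.sum_insert ha, ih, exp_add]
  rw [tabWeight_eq hSc, map_prod]
  refine (Finset.prod_le_prod' hle).trans ?_
  rw [hexp, exp_le_exp, Finset.sum_sub_distrib, hnum]
  simp only [Finset.sum_const, nsmul_eq_mul, mul_one, ← Nat.cast_sum]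
  have : ∑ p ∈ S, (if p ∈ E then B p else 0) ≤ ∑ p ∈ E, B p := by
    rw [← Finset.sum_filter]
    exact Finset.sum_le_sum_of_subset fun p hp => (Finset.mem_filter.1 hp).2
  omega

end APSYT

/-- The APSYT whose labels are consecutive on the first row outside `λ^{(n)}`. -/
theorem exists_exhaustion {μ : YoungDiagram} {T : ℕ × ℕ → ℕ} (hT : IsOmega μ T) (N : ℕ) :
    ∃ F : Finset {τ : ℕ × ℕ → ℕ × ℕ // IsAPSYT μ T τ},
      ∑ τ ∈ F, tabWeight μ T τ.1 = tFact tL (rkOmega μ T + N) * pairProd μ T (rkOmega μ T + N) ∧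
      ∀ τ ∉ F, N ≤ invNumInf μ T τ.1 := by
  have hn : rkOmega μ T ≤ rkOmega μ T + N := Nat.le_add_right _ _
  obtain ⟨e, he, hs, hlt⟩ := exists_enum (T := T) (hatCells μ (rkOmega μ T + N))
    (card_hatCells ((card_le_rkOmega hT).trans hn))
  refine ⟨(Finset.univ.image (tabOfPerm μ T e)).subtype (IsAPSYT μ T), ?_, ?_⟩
  · rw [Finset.sum_subtype_eq_sum_filter, Finset.sum_filter_of_ne,
      Finset.sum_image (tabOfPerm_injective he).injOn, sum_tabWeight_tabOfPerm hT hn he hs hlt]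
    intro τ hτ hW
    obtain ⟨w, -, rfl⟩ := Finset.mem_image.1 hτ
    exact (isAPSYT_tabOfPerm_or hT hn he hs hlt w).resolve_right hW
  · rintro ⟨τ, hτ⟩ hmem
    rw [Finset.mem_subtype] at hmem
    by_contra! hlt'
    apply hmem
    obtain ⟨w, hw⟩ := hτ.exists_perm hT hn he hs fun k hk => by
      by_contra hne
      have := hτ.le_invNumInf hT hn hk hne
      simp only at hlt'
      omega
    exact Finset.mem_image.2 ⟨w, Finset.mem_univ _, hw⟩

section limit

variable {μ : YoungDiagram} {T : ℕ × ℕ → ℕ}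

theorem pairProd_succ (hT : IsOmega μ T) {n : ℕ} (hn : rkOmega μ T ≤ n) :
    pairProd μ T (n + 1) =
      pairProd μ T n * ∏ c ∈ hatCells μ n, pairWeight T c (0, n - μ.card) := by
  have hcard := (card_le_rkOmega hT).trans hn
  have hb : (0, n - μ.card) ∉ hatCells μ n := by rw [zero_mem_hatCells]; exact lt_irrefl _
  have hlt : ∀ c ∈ hatCells μ n, boxLT T c (0, n - μ.card) := fun c hc =>
    hT.boxLT_tail hn le_rfl hc
  rw [pairProd, hatCells_succ hcard, Finset.prod_insert hb, Finset.prod_insert hb,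
    if_neg (boxLT_irrefl _ _),
    Finset.prod_congr rfl fun c hc => if_neg (boxLT_asymm (hlt c hc)),
    Finset.prod_const_one, mul_one, one_mul, pairProd, ← Finset.prod_mul_distrib]
  refine Finset.prod_congr rfl fun c hc => ?_
  rw [Finset.prod_insert hb, if_pos (hlt c hc), mul_comm]

theorem prod_hatCells_add {n : ℕ} (hn : μ.card ≤ n) (f : ℕ × ℕ → LK) (N : ℕ) :
    ∏ c ∈ hatCells μ (n + N), f c =
      (∏ c ∈ hatCells μ n, f c) * ∏ k ∈ Finset.range N, f (0, n - μ.card + k) := by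
  induction N with
  | zero => simp
  | succ N ih =>
    rw [← add_assoc, hatCells_succ (by omega), Finset.prod_insert, ih, Finset.prod_range_succ,
      show n + N - μ.card = n - μ.card + N by omega]
    · ring
    · rw [zero_mem_hatCells]; exact lt_irrefl _

theorem prod_one_sub_pow_div (N : ℕ) :
    ∏ k ∈ Finset.range N, (1 - tL ^ (k + 1)) / (1 - tL ^ (k + 2)) =
      (1 - tL) / (1 - tL ^ (N + 1)) := by
  induction N with
  | zero =>
    have := one_sub_tL_pow_ne_zero one_ne_zero
    rw [pow_one] at this
    simp [div_self this]
  | succ N ih =>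
    have h1 := one_sub_tL_pow_ne_zero (Nat.succ_ne_zero N)
    rw [Finset.prod_range_succ, ih, div_mul_div_cancel₀ h1]

theorem pairWeight_of_eq_of_row_eq {i j l : ℕ} (h : T (i, l) = T (i, j)) (hl : l ≤ j) :
    pairWeight T (i, l) (i, j) = (1 - tL ^ (j - l)) / (1 - tL ^ (j - l + 1)) := by
  have h0 := boxVar_ne_zero T (i, l)
  have hX : boxVar T (i, j) = boxVar T (i, l) * tL ^ (j - l) := by
    rw [boxVar, boxVar, h, mul_assoc, ← zpow_natCast tL (j - l), ← zpow_add₀ tL_ne_zero]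
    congr 2
    simp only [content]
    push_cast [hl]
    ring
  rw [pairWeight, hX]
  have h1 : boxVar T (i, l) - boxVar T (i, l) * tL ^ (j - l) =
      boxVar T (i, l) * (1 - tL ^ (j - l)) := by ring
  have h2 : boxVar T (i, l) - tL * (boxVar T (i, l) * tL ^ (j - l)) =
      boxVar T (i, l) * (1 - tL ^ (j - l + 1)) := by ring
  rw [h1, h2, mul_div_mul_left _ _ h0]

theorem prod_pairWeight_tail (hT : IsOmega μ T) (N : ℕ) :
    ∏ k ∈ Finset.range N, pairWeight T (0, rkOmega μ T - μ.card + k)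
        (0, rkOmega μ T - μ.card + N) = (1 - tL) / (1 - tL ^ (N + 1)) := by
  rw [← prod_one_sub_pow_div, ← Finset.prod_range_reflect]
  refine Finset.prod_congr rfl fun k hk => ?_
  rw [Finset.mem_range] at hk
  rw [pairWeight_of_eq_of_row_eq _ (by omega)]
  · rw [show rkOmega μ T - μ.card + N - (rkOmega μ T - μ.card + (N - 1 - k)) = k + 1 by omega]
  · rw [hT.eq_zero_of_rk_le (by omega), hT.eq_zero_of_rk_le (by omega)]

/-- The product over the boxes of `λ^{(rk T)}` in the closed formula, shifted by `N`. -/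
noncomputable def boxProd (μ : YoungDiagram) (T : ℕ × ℕ → ℕ) (N : ℕ) : LK :=
  ∏ c ∈ hatCells μ (rkOmega μ T), (1 - tL ^ (rkOmega μ T - μ.card + N) / boxVar T c)

theorem boxProd_ne_zero (hT : IsOmega μ T) (N : ℕ) : boxProd μ T N ≠ 0 := by
  refine Finset.prod_ne_zero_iff.2 fun c hc h => ?_
  have h1 : qL ^ (T c : ℤ) * tL ^ content c =
      qL ^ (0 : ℤ) * tL ^ ((rkOmega μ T - μ.card + N : ℕ) : ℤ) := by
    rw [zpow_zero, one_mul, zpow_natCast]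
    exact ((div_eq_one_iff_eq (boxVar_ne_zero T c)).1 (sub_eq_zero.1 h).symm).symm
  have h2 := (qL_zpow_mul_tL_zpow_inj h1).2
  have h3 := col_lt_of_mem_hatCells (rkOmega_spec hT).1 hc
  unfold content at h2
  omega

theorem prod_pairWeight_boxes (hT : IsOmega μ T) (N : ℕ) :
    ∏ c ∈ hatCells μ (rkOmega μ T), pairWeight T c (0, rkOmega μ T - μ.card + N) =
      boxProd μ T N / boxProd μ T (N + 1) := by
  rw [boxProd, boxProd, ← Finset.prod_div_distrib]
  refine Finset.prod_congr rfl fun c _ => ?_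
  have h0 := boxVar_ne_zero T c
  have hX : boxVar T (0, rkOmega μ T - μ.card + N) = tL ^ (rkOmega μ T - μ.card + N) := by
    rw [boxVar, hT.eq_zero_of_rk_le (by omega)]
    simp only [content]
    rw [Nat.cast_zero, zpow_zero, one_mul, sub_zero, zpow_natCast]
  rw [pairWeight, hX, one_sub_div h0, one_sub_div h0, div_div_div_cancel_right₀ h0, ← pow_succ',
    add_assoc]

theorem tFact_mul_pairProd (hT : IsOmega μ T) (N : ℕ) :
    tFact tL (rkOmega μ T + N) * pairProd μ T (rkOmega μ T + N) =
      pairProd μ T (rkOmega μ T) * (boxProd μ T 0 / boxProd μ T N) *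
        ((∏ k ∈ Finset.range (rkOmega μ T), (1 - tL ^ (N + 1 + k))) /
          (1 - tL) ^ rkOmega μ T) := by
  induction N with
  | zero =>
    rw [div_self (boxProd_ne_zero hT 0), mul_one, add_zero, mul_comm, tFact,
      Finset.prod_div_distrib, Finset.prod_const, Finset.card_range]
    simp only [zero_add, add_comm]
  | succ N ih =>
    have ht : 1 - tL ≠ 0 := by simpa using one_sub_tL_pow_ne_zero one_ne_zero
    have hN := one_sub_tL_pow_ne_zero (Nat.succ_ne_zero N)
    have hB := boxProd_ne_zero hT N
    have hB' := boxProd_ne_zero hT (N + 1)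
    have hP : (∏ k ∈ Finset.range (rkOmega μ T), (1 - tL ^ (N + 1 + 1 + k))) *
        (1 - tL ^ (N + 1)) = (∏ k ∈ Finset.range (rkOmega μ T), (1 - tL ^ (N + 1 + k))) *
        (1 - tL ^ (rkOmega μ T + N + 1)) := by
      have h1 := Finset.prod_range_succ (fun k => 1 - tL ^ (N + 1 + k)) (rkOmega μ T)
      have h2 := Finset.prod_range_succ' (fun k => 1 - tL ^ (N + 1 + k)) (rkOmega μ T)
      rw [h1] at h2
      rw [show rkOmega μ T + N + 1 = N + 1 + rkOmega μ T by ring, h2]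
      simp only [add_assoc, add_comm 1, add_zero]
    rw [← add_assoc, pairProd_succ hT (Nat.le_add_right _ _),
      prod_hatCells_add (card_le_rkOmega hT),
      show rkOmega μ T + N - μ.card = rkOmega μ T - μ.card + N by
        have := card_le_rkOmega hT; omega,
      prod_pairWeight_tail hT, prod_pairWeight_boxes hT, tFact, Finset.prod_range_succ, ← tFact]
    calc _ = (tFact tL (rkOmega μ T + N) * pairProd μ T (rkOmega μ T + N)) *
          ((1 - tL ^ (rkOmega μ T + N + 1)) / (1 - tL ^ (N + 1)) *
            (boxProd μ T N / boxProd μ T (N + 1))) := by field_simp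
      _ = _ := by
        rw [ih, eq_div_of_mul_eq hN hP]
        field_simp

theorem tendsto_prod_one_sub {ι : Type*} (s : Finset ι) (f : ℕ → ι → LK)
    (hf : ∀ i ∈ s, Filter.Tendsto (fun N => f N i) Filter.atTop (nhds 0)) :
    Filter.Tendsto (fun N => ∏ i ∈ s, (1 - f N i)) Filter.atTop (nhds 1) := by
  have := tendsto_finsetProd s fun i hi => (tendsto_const_nhds (x := (1 : LK))).sub (hf i hi)
  simpa using this

theorem tendsto_tFact_mul_pairProd (hT : IsOmega μ T) :
    Filter.Tendsto (fun N => tFact tL (rkOmega μ T + N) * pairProd μ T (rkOmega μ T + N))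
      Filter.atTop
      (nhds (pairProd μ T (rkOmega μ T) * boxProd μ T 0 * (1 / (1 - tL) ^ rkOmega μ T))) := by
  simp_rw [tFact_mul_pairProd hT]
  have hshift : ∀ m : ℕ, Filter.Tendsto (fun N : ℕ => tL ^ (N + m)) Filter.atTop (nhds 0) :=
    fun m => (Filter.tendsto_add_atTop_iff_nat m).2 tendsto_tL_pow
  have hB : Filter.Tendsto (fun N => boxProd μ T N) Filter.atTop (nhds 1) := by
    refine tendsto_prod_one_sub _ _ fun c _ => ?_
    have := (hshift (rkOmega μ T - μ.card)).div_const (boxVar T c)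
    simpa only [zero_div, add_comm] using this
  have hP : Filter.Tendsto
      (fun N : ℕ => ∏ k ∈ Finset.range (rkOmega μ T), (1 - tL ^ (N + 1 + k)))
      Filter.atTop (nhds 1) :=
    tendsto_prod_one_sub _ _ fun k _ => by simpa only [add_assoc] using hshift (1 + k)
  have h := (((tendsto_const_nhds (x := boxProd μ T 0)).div hB one_ne_zero).const_mul
    (pairProd μ T (rkOmega μ T))).mul (hP.div_const ((1 - tL) ^ rkOmega μ T))
  rwa [div_one] at h

end limit

theorem minTab_lt_iff {s : Finset (ℕ × ℕ)} {T : ℕ × ℕ → ℕ} {c c' : ℕ × ℕ} (hc : c ∈ s)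
    (hc' : c' ∈ s) : (minTab s T c').1 < (minTab s T c).1 ↔ minOrd T c' c := by
  have hmono : ∀ {a b : ℕ × ℕ}, a ∈ s → minOrd T a b →
      (s.filter fun x => minOrd T x a).card < (s.filter fun x => minOrd T x b).card := by
    intro a b ha hab
    refine Finset.card_lt_card ((Finset.ssubset_iff_of_subset fun x hx => ?_).2 ⟨a, ?_, ?_⟩)
    · rw [Finset.mem_filter] at *
      refine ⟨hx.1, ?_⟩
      have := hx.2
      unfold minOrd rowReadLT at *
      omega
    · exact Finset.mem_filter.2 ⟨ha, hab⟩
    · intro h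
      have := (Finset.mem_filter.1 h).2
      unfold minOrd rowReadLT at this
      omega
  rw [minTab, minTab, if_pos hc, if_pos hc']
  simp only [add_lt_add_iff_right]
  refine ⟨fun h => ?_, hmono hc'⟩
  by_contra hn
  rcases eq_or_ne c c' with rfl | hne
  · exact lt_irrefl _ h
  · have h1 : c.1 ≠ c'.1 ∨ c.2 ≠ c'.2 := by
      by_contra! h'
      exact hne (Prod.ext h'.1 h'.2)
    have h2 : minOrd T c c' := by
      unfold minOrd rowReadLT at *
      omega
    exact lt_asymm h (hmono hc h2)

theorem mem_hatCells_of_le {μ : YoungDiagram} {n i j l : ℕ} (h : (i, j) ∈ hatCells μ n)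
    (hl : l ≤ j) : (i, l) ∈ hatCells μ n := by
  rw [mem_hatCells] at *
  cases i with
  | zero => exact lt_of_le_of_lt hl h
  | succ i => exact μ.up_left_mem le_rfl hl h

theorem prod_pairWeight_run {μ : YoungDiagram} {T : ℕ × ℕ → ℕ} (hT : IsOmega μ T) {n : ℕ}
    {c' : ℕ × ℕ} (hc' : c' ∈ hatCells μ n) :
    (∏ c ∈ hatCells μ n, if boxLT T c c' ∧ ¬ minOrd T c' c then pairWeight T c c' else 1) =
      (1 - tL) / (1 - tL ^ runPos (hatCells μ n) T c') := by
  obtain ⟨i, j⟩ := c'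
  have hex : ∃ l, T (i, l) = T (i, j) := ⟨j, rfl⟩
  obtain ⟨l₀, hl₀, hmin⟩ : ∃ l₀, T (i, l₀) = T (i, j) ∧ ∀ l, T (i, l) = T (i, j) → l₀ ≤ l :=
    ⟨Nat.find hex, Nat.find_spec hex, fun l hl => Nat.find_min' hex hl⟩
  have hl₀j := hmin j rfl
  have hcell := cellInf_of_mem_hatCells hc'
  have hrun : ∀ l, l₀ ≤ l → l ≤ j → T (i, l) = T (i, j) := fun l h1 h2 =>
    le_antisymm (hl₀ ▸ hT.row_le (cellInf_of_le hcell le_rfl h2) h1) (hT.row_le hcell h2)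
  have hpos : runPos (hatCells μ n) T (i, j) = j - l₀ + 1 := by
    have : ((Finset.range (j + 1)).filter fun l =>
        ∀ m, l ≤ m → m ≤ j → ((i, m) ∈ hatCells μ n ∧ T (i, m) = T (i, j))) =
        Finset.Ico l₀ (j + 1) := by
      ext l
      rw [Finset.mem_filter, Finset.mem_range, Finset.mem_Ico]
      constructor
      · rintro ⟨h1, h2⟩
        exact ⟨hmin l (h2 l le_rfl (by omega)).2, h1⟩
      · rintro ⟨h1, h2⟩
        exact ⟨h2, fun m hm hmj => ⟨mem_hatCells_of_le hc' hmj, hrun m (h1.trans hm) hmj⟩⟩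
    change Finset.card _ = _
    rw [this, Nat.card_Ico]
    omega
  have hset : (hatCells μ n).filter (fun c => boxLT T c (i, j) ∧ ¬ minOrd T (i, j) c) =
      (Finset.Ico l₀ j).image (Prod.mk i) := by
    ext ⟨i', l⟩
    simp only [Finset.mem_filter, Finset.mem_image, Finset.mem_Ico, Prod.mk.injEq]
    constructor
    · rintro ⟨h1, h2, h3⟩
      have h4 : T (i', l) = T (i, j) := by
        unfold boxLT minOrd at *
        omega
      have h5 := hT.of_boxLT_of_eq (cellInf_of_mem_hatCells h1) hcell h2 h4
      have h6 : i = i' := by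
        unfold minOrd rowReadLT at h3
        simp only at h3 h5
        omega
      subst h6
      exact ⟨l, ⟨hmin l h4, h5.1⟩, rfl, rfl⟩
    · rintro ⟨l, ⟨h1, h2⟩, rfl, rfl⟩
      have h3 := hrun l h1 h2.le
      refine ⟨mem_hatCells_of_le hc' h2.le, Or.inr ⟨h3, Or.inl h2⟩, ?_⟩
      unfold minOrd rowReadLT
      simp only
      omega
  rw [← Finset.prod_filter, hset, Finset.prod_image (fun _ _ _ _ h => (Prod.mk.inj h).2), hpos,
    ← prod_one_sub_pow_div, Finset.prod_Ico_eq_prod_range, ← Finset.prod_range_reflect]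
  refine Finset.prod_congr rfl fun k hk => ?_
  rw [Finset.mem_range] at hk
  rw [pairWeight_of_eq_of_row_eq (hrun _ (by omega) (by omega)) (by omega),
    show j - (l₀ + (j - l₀ - 1 - k)) = k + 1 by omega]

theorem pairProd_eq {μ : YoungDiagram} {T : ℕ × ℕ → ℕ} (hT : IsOmega μ T) (n : ℕ) :
    pairProd μ T n =
      (∏ p ∈ invSet (hatCells μ n) T (minTab (hatCells μ n) T), pairWeight T p.1 p.2) /
        muFact tL (hatCells μ n) T := by
  have hsplit : pairProd μ T n =
      (∏ c ∈ hatCells μ n, ∏ c' ∈ hatCells μ n,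
        if boxLT T c c' ∧ minOrd T c' c then pairWeight T c c' else 1) *
      ∏ c' ∈ hatCells μ n, ∏ c ∈ hatCells μ n,
        if boxLT T c c' ∧ ¬ minOrd T c' c then pairWeight T c c' else 1 := by
    rw [Finset.prod_comm (s := hatCells μ n) (t := hatCells μ n)
      (f := fun c' c => if boxLT T c c' ∧ ¬ minOrd T c' c then pairWeight T c c' else 1)]
    simp_rw [← Finset.prod_mul_distrib]
    refine Finset.prod_congr rfl fun c _ => Finset.prod_congr rfl fun c' _ => ?_
    by_cases h1 : boxLT T c c' <;> by_cases h2 : minOrd T c' c <;> simp [h1, h2]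
  rw [hsplit, Finset.prod_congr rfl fun c' hc' => prod_pairWeight_run hT hc', muFact,
    div_eq_mul_inv, ← Finset.prod_inv_distrib, ← Finset.prod_product', ← Finset.prod_filter]
  simp_rw [inv_div]
  congr 2
  refine Finset.filter_congr fun p hp => ?_
  rw [Finset.mem_product] at hp
  rw [minTab_lt_iff hp.1 hp.2]

theorem exists_aeval_div_of_mem_adjoin {L : LK}
    (hL : L ∈ IntermediateField.adjoin ℚ (Set.range ![qL, tL])) :
    ∃ P Q : MvPolynomial (Fin 2) ℚ, MvPolynomial.aeval ![qL, tL] Q ≠ 0 ∧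
      L = MvPolynomial.aeval ![qL, tL] P / MvPolynomial.aeval ![qL, tL] Q := by
  obtain ⟨P, Q, h⟩ := (IntermediateField.mem_adjoin_range_iff ℚ ![qL, tL] L).1 hL
  by_cases hQ : MvPolynomial.aeval ![qL, tL] Q = 0
  · refine ⟨0, 1, by simp, ?_⟩
    rw [h, hQ]
    simp
  · exact ⟨P, Q, hQ, h⟩

theorem boxVar_mem_adjoin (T : ℕ × ℕ → ℕ) (c : ℕ × ℕ) :
    boxVar T c ∈ IntermediateField.adjoin ℚ (Set.range ![qL, tL]) :=
  mul_mem (zpow_mem (IntermediateField.subset_adjoin ℚ _ (Set.mem_range_self (0 : Fin 2))) _)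
    (zpow_mem (IntermediateField.subset_adjoin ℚ _ (Set.mem_range_self (1 : Fin 2))) _)

theorem closedForm_mem_adjoin (μ : YoungDiagram) (T : ℕ × ℕ → ℕ) :
    pairProd μ T (rkOmega μ T) * boxProd μ T 0 * (1 / (1 - tL) ^ rkOmega μ T) ∈
      IntermediateField.adjoin ℚ (Set.range ![qL, tL]) := by
  have ht : tL ∈ IntermediateField.adjoin ℚ (Set.range ![qL, tL]) :=
    IntermediateField.subset_adjoin _ _ ⟨1, rfl⟩
  refine mul_mem (mul_mem (prod_mem fun c _ => prod_mem fun c' _ => ?_) (prod_mem fun c _ => ?_))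
    (div_mem (one_mem _) (pow_mem (sub_mem (one_mem _) ht) _))
  · split_ifs
    · exact div_mem (sub_mem (boxVar_mem_adjoin T c) (boxVar_mem_adjoin T c'))
        (sub_mem (boxVar_mem_adjoin T c) (mul_mem ht (boxVar_mem_adjoin T c')))
    · exact one_mem _
  · exact sub_mem (one_mem _) (div_mem (pow_mem ht _) (boxVar_mem_adjoin T c))

theorem hasSum_tabWeight {μ : YoungDiagram} {T : ℕ × ℕ → ℕ} (hT : IsOmega μ T) :
    HasSum (fun τ : {τ : ℕ × ℕ → ℕ × ℕ // IsAPSYT μ T τ} => tabWeight μ T τ.1)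
      (pairProd μ T (rkOmega μ T) * boxProd μ T 0 * (1 / (1 - tL) ^ rkOmega μ T)) := by
  choose F hF hF' using exists_exhaustion hT
  obtain ⟨C, hC⟩ := exists_valuation_tabWeight_le hT
  refine hasSum_of_exhaustion _ _ F ?_ fun D => ?_
  · simp_rw [hF]
    exact tendsto_tFact_mul_pairProd hT
  · filter_upwards [Filter.eventually_ge_atTop (C + D)] with n hn τ hτ
    refine (hC τ.1 τ.2).trans (WithZero.exp_le_exp.2 ?_)
    have := hF' n τ hτ
    omega

/-- Let `λ` be a partition and `T ∈ Ω(λ)`. The family indexed by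
`τ ∈ APSYT(λ;T)` of the elements
`t^{inv(τ)} · Π_{(□₁,□₂) ∈ Inv(τ)} (1 − q^{T□₂−T□₁} t^{c□₂−c□₁−1})/(1 − q^{T□₂−T□₁} t^{c□₂−c□₁+1})`
of `K = ℚ(q)((t))` is summable in the `t`-adic topology, with sum
`(Π_{□ ∈ λ^{(rk T)}} (1 − q^{−T□} t^{rk T−|λ|−c□}) / ((1−t)^{rk T} [μ(T|)]_t!)) ·
Π_{(□₁,□₂) ∈ I(T|)} (1 − q^{T□₂−T□₁} t^{c□₂−c□₁})/(1 − q^{T□₂−T□₁} t^{c□₂−c□₁+1})`;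
in particular the sum lies in the image of `ℚ(q,t)` in `K`. -/
theorem statement19 (μ : YoungDiagram) (T : ℕ × ℕ → ℕ) (hT : IsOmega μ T) :
    ∃ L : LK,
      L = ((∏ c ∈ hatCells μ (rkOmega μ T),
            (1 - qL ^ (-(restLam μ (rkOmega μ T) T c : ℤ)) *
              tL ^ ((rkOmega μ T : ℤ) - (μ.card : ℤ) - content c))) /
          ((1 - tL) ^ rkOmega μ T *
            muFact tL (hatCells μ (rkOmega μ T)) (restLam μ (rkOmega μ T) T))) *
        (∏ p ∈ invSet (hatCells μ (rkOmega μ T)) (restLam μ (rkOmega μ T) T)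
            (minTab (hatCells μ (rkOmega μ T)) (restLam μ (rkOmega μ T) T)),
          (1 - qL ^ ((restLam μ (rkOmega μ T) T p.2 : ℤ) -
                (restLam μ (rkOmega μ T) T p.1 : ℤ)) *
              tL ^ (content p.2 - content p.1)) /
            (1 - qL ^ ((restLam μ (rkOmega μ T) T p.2 : ℤ) -
                (restLam μ (rkOmega μ T) T p.1 : ℤ)) *
              tL ^ (content p.2 - content p.1 + 1))) ∧
      HasSum
        (fun τ : {τ : ℕ × ℕ → ℕ × ℕ // IsAPSYT μ T τ} =>
          tL ^ invNumInf μ T τ.1 *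
            ∏ᶠ p ∈ invSetInf μ T τ.1,
              (1 - qL ^ ((T p.2 : ℤ) - (T p.1 : ℤ)) *
                  tL ^ (content p.2 - content p.1 - 1)) /
                (1 - qL ^ ((T p.2 : ℤ) - (T p.1 : ℤ)) *
                  tL ^ (content p.2 - content p.1 + 1)))
        L ∧
      ∃ P Q : MvPolynomial (Fin 2) ℚ,
        MvPolynomial.aeval ![qL, tL] Q ≠ 0 ∧
        L = MvPolynomial.aeval ![qL, tL] P / MvPolynomial.aeval ![qL, tL] Q := by
  refine ⟨pairProd μ T (rkOmega μ T) * boxProd μ T 0 * (1 / (1 - tL) ^ rkOmega μ T), ?_,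
    hasSum_tabWeight hT, exists_aeval_div_of_mem_adjoin (closedForm_mem_adjoin μ T)⟩
  have hbox : boxProd μ T 0 = ∏ c ∈ hatCells μ (rkOmega μ T),
      (1 - qL ^ (-(T c : ℤ)) * tL ^ ((rkOmega μ T : ℤ) - (μ.card : ℤ) - content c)) := by
    refine Finset.prod_congr rfl fun c _ => ?_
    rw [add_zero, zpow_sub₀ tL_ne_zero, ← Nat.cast_sub (card_le_rkOmega hT), zpow_natCast,
      zpow_neg, boxVar, div_mul_eq_div_div_swap]
    ring
  rw [restLam_rkOmega hT]
  simp_rw [pairWeight_eq]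
  rw [← hbox, pairProd_eq hT, mul_comm ((1 - tL) ^ rkOmega μ T), div_mul_eq_mul_div,
    mul_one_div, div_mul_eq_mul_div, div_div, mul_comm (boxProd μ T 0)]
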